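/- Assume each kernel k^j is positive semidefinite and Assumption 1 holds, and let μ be any probability measure on 𝒳 that is not equal to the product of its marginals. For the i.i.d. sample D of size n from μ, let t_n^1(D) ≥ t_n^2(D) ≥ ⋯ ≥ t_n^{(n!)^{d−1}}(D) be the values dHSIĈ(ψD) over all (n!)^{d−1} permutation vectors ψ, arranged in decreasing order, and for α ∈ (0,1) set a = ⌊α (n!)^{d−1}⌋. Then t_n^a(D) converges to 0 in probability as n → ∞. -/

import Mathlib

open MeasureTheory ProbabilityTheory Filter
open scoped ENNReal Classical

instance (n : ℕ) : MeasurableSpace (Equiv.Perm (Fin n)) := ⊤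

/-- The action of a permutation vector `ψ = (ψ^1, …, ψ^{d-1})` on a dataset:
the first coordinate is kept fixed and coordinate `j+1` is permuted by `ψ^j`. -/
def permAct {d n : ℕ} {𝒳 : Fin d → Type*} (ψ : Fin (d-1) → Equiv.Perm (Fin n))
    (D : Fin n → ∀ j, 𝒳 j) : Fin n → ∀ j, 𝒳 j :=
  fun i j => if h : j.val = 0 then D i j
    else D ((ψ ⟨j.val - 1, by have := j.isLt; omega⟩) i) j

/-- The empirical dHSIC statistic of a dataset `(x_1, …, x_n)`, built from kernels
`k^1, …, k^d`. -/
noncomputable def dHSIC {d n : ℕ} {𝒳 : Fin d → Type*} (k : ∀ j, 𝒳 j → 𝒳 j → ℝ)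
    (x : Fin n → ∀ j, 𝒳 j) : ℝ :=
  (1/(n:ℝ)^2) * ∑ i : Fin n × Fin n, ∏ j, k j (x i.1 j) (x i.2 j)
  + (1/(n:ℝ)^(2*d)) * ∑ i : Fin (2*d) → Fin n, ∏ j : Fin d,
      k j (x (i ⟨2*j.val, by have := j.isLt; omega⟩) j)
          (x (i ⟨2*j.val+1, by have := j.isLt; omega⟩) j)
  - (2/(n:ℝ)^(d+1)) * ∑ i : Fin (d+1) → Fin n, ∏ j : Fin d,
      k j (x (i 0) j) (x (i j.succ) j)

/-- A kernel is positive semidefinite if it is symmetric and all its Gram matrices are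
positive semidefinite. -/
def IsPSDKernel {α : Type*} (k : α → α → ℝ) : Prop :=
  (∀ x y, k x y = k y x) ∧
    ∀ (m : ℕ) (x : Fin m → α) (c : Fin m → ℝ),
      0 ≤ ∑ a : Fin m, ∑ b : Fin m, c a * c b * k (x a) (x b)

/-- Assumption 1: there is a uniform bound `C` on `E |∏_j k^j(Y_{τ(2j-1)}, Y_{τ(2j)})|`
over all index maps `τ`, where `Y_1, …, Y_{2d}` are i.i.d. with law `μ`. -/
def Assumption1 {d : ℕ} {𝒳 : Fin d → Type*} [∀ j, MeasurableSpace (𝒳 j)]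
    (k : ∀ j, 𝒳 j → 𝒳 j → ℝ) (μ : Measure (∀ j, 𝒳 j)) : Prop :=
  ∃ C : ℝ, ∀ τ : Fin (2*d) → Fin (2*d),
    ∫⁻ Y in Set.univ, ENNReal.ofReal |∏ j : Fin d,
        k j (Y (τ ⟨2*j.val, by have := j.isLt; omega⟩) j)
            (Y (τ ⟨2*j.val+1, by have := j.isLt; omega⟩) j)|
      ∂(Measure.pi fun _ : Fin (2*d) => μ) ≤ ENNReal.ofReal C

/-- The `a`-th largest value (counted with multiplicity) of a finite family of reals
indexed by a fintype `ι`; it is the `(card ι - a)`-th entry (0-indexed) of the family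
sorted in increasing order. -/
noncomputable def kthLargest {ι : Type*} [Fintype ι] (f : ι → ℝ) (a : ℕ) : ℝ :=
  ((Finset.univ.val.map f).sort (· ≤ ·)).getD (Fintype.card ι - a) 0

/-- Interleaving of two `d`-tuples into a `2d`-tuple. -/
def interleaveEquiv (d : ℕ) (γ : Type*) :
    ((Fin d → γ) × (Fin d → γ)) ≃ (Fin (2 * d) → γ) where
  toFun p m := if m.val % 2 = 0 then p.1 ⟨m.val / 2, by omega⟩ else p.2 ⟨m.val / 2, by omega⟩
  invFun s := (fun j => s ⟨2 * j.val, by omega⟩, fun j => s ⟨2 * j.val + 1, by omega⟩)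
  left_inv p := by
    ext j
    · simp
    · have h : (2 * j.val + 1) / 2 = j.val := by omega
      simp [h]
  right_inv s := by
    ext m
    by_cases h : m.val % 2 = 0
    · have h' : 2 * (m.val / 2) = m.val := by omega
      simp [h, h']
    · have h' : 2 * (m.val / 2) + 1 = m.val := by omega
      simp [h, h']

lemma interleaveEquiv_even {d : ℕ} {γ : Type*} (a b : Fin d → γ) (j : Fin d)
    (h : 2 * j.val < 2 * d) : interleaveEquiv d γ (a, b) ⟨2 * j.val, h⟩ = a j := by
  simp [interleaveEquiv]

lemma interleaveEquiv_odd {d : ℕ} {γ : Type*} (a b : Fin d → γ) (j : Fin d)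
    (h : 2 * j.val + 1 < 2 * d) : interleaveEquiv d γ (a, b) ⟨2 * j.val + 1, h⟩ = b j := by
  have h' : (2 * j.val + 1) / 2 = j.val := by omega
  simp [interleaveEquiv, h']

/-- The product kernel of a dataset, evaluated at two tuples of indices. -/
def tensorKernel {ι : Type*} {d : ℕ} {𝒳 : Fin d → Type*} (k : ∀ j, 𝒳 j → 𝒳 j → ℝ)
    (x : ι → ∀ j, 𝒳 j) (a b : Fin d → ι) : ℝ :=
  ∏ j, k j (x (a j) j) (x (b j) j)

/-- The signed measure on index tuples given by the uniform measure on the diagonal plus `s` times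
the uniform measure on all tuples. -/
noncomputable def tupleWeight (d n : ℕ) (s : ℝ) (a : Fin d → Fin n) : ℝ :=
  (1 / (n : ℝ)) * ∑ i : Fin n, (if a = fun _ => i then 1 else 0) + s * (1 / (n : ℝ) ^ d)

lemma sum_tupleWeight_mul {d n : ℕ} (s : ℝ) (h : (Fin d → Fin n) → ℝ) :
    ∑ a, tupleWeight d n s a * h a =
      (1 / (n : ℝ)) * ∑ i : Fin n, h (fun _ => i) + s * (1 / (n : ℝ) ^ d) * ∑ a, h a := by
  simp only [tupleWeight, add_mul, Finset.sum_add_distrib, mul_assoc, ← Finset.mul_sum,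
    Finset.sum_mul]
  rw [Finset.sum_comm]
  simp

lemma sum_tupleWeight {d n : ℕ} (hn : n ≠ 0) (s : ℝ) : ∑ a, tupleWeight d n s a = 1 + s := by
  have h := sum_tupleWeight_mul (d := d) (n := n) s (fun _ => 1)
  have hn' : (n : ℝ) ≠ 0 := by exact_mod_cast hn
  simp only [mul_one, Finset.sum_const, Finset.card_univ, Fintype.card_fin, Fintype.card_fun,
    nsmul_eq_mul, Nat.cast_pow] at h
  rw [h]
  field_simp

lemma tupleWeight_nonneg {d n : ℕ} {s : ℝ} (hs : 0 ≤ s) (a : Fin d → Fin n) :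
    0 ≤ tupleWeight d n s a := by
  unfold tupleWeight
  have : 0 ≤ ∑ i : Fin n, (if a = fun _ => i then (1 : ℝ) else 0) :=
    Finset.sum_nonneg fun i _ => by split_ifs <;> simp
  positivity

lemma abs_tupleWeight_le {d n : ℕ} (a : Fin d → Fin n) :
    |tupleWeight d n (-1) a| ≤ tupleWeight d n 1 a := by
  have h : 0 ≤ ∑ i : Fin n, (if a = fun _ => i then (1 : ℝ) else 0) :=
    Finset.sum_nonneg fun i _ => by split_ifs <;> simp
  have h1 : 0 ≤ (1 / (n : ℝ)) * ∑ i : Fin n, (if a = fun _ => i then (1 : ℝ) else 0) := by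
    positivity
  have h2 : 0 ≤ 1 / (n : ℝ) ^ d := by positivity
  unfold tupleWeight
  rw [abs_le]
  constructor <;> linarith

lemma card_tuple_coord_eq {d n : ℕ} (j : Fin d) (i : Fin n) :
    (n : ℝ) * ∑ a : Fin d → Fin n, (if a j = i then (1 : ℝ) else 0) = (n : ℝ) ^ d := by
  have : NeZero n := ⟨fun h => by subst h; exact i.elim0⟩
  have hshift : ∀ t : Fin n, ∑ a : Fin d → Fin n, (if a j = i then (1 : ℝ) else 0) =
      ∑ a : Fin d → Fin n, (if t + a j = i then (1 : ℝ) else 0) := fun t =>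
    (Equiv.sum_comp (Equiv.addLeft (fun _ => t)) _).symm
  calc (n : ℝ) * ∑ a : Fin d → Fin n, (if a j = i then (1 : ℝ) else 0)
      = ∑ t : Fin n, ∑ a : Fin d → Fin n, (if t + a j = i then (1 : ℝ) else 0) := by
        simp [← hshift]
    _ = (n : ℝ) ^ d := by
        rw [Finset.sum_comm]
        simp [← eq_sub_iff_add_eq]

lemma sum_tupleWeight_one_coord_eq {d n : ℕ} (j : Fin d) (i : Fin n) :
    ∑ a, tupleWeight d n 1 a * (if a j = i then 1 else 0) = 2 / n := by
  have hn : (n : ℝ) ≠ 0 := by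
    have : n ≠ 0 := fun h => by subst h; exact i.elim0
    exact_mod_cast this
  have h : ∑ a : Fin d → Fin n, (if a j = i then (1 : ℝ) else 0) = (n : ℝ) ^ d / n := by
    rw [eq_div_iff hn, mul_comm, card_tuple_coord_eq]
  rw [sum_tupleWeight_mul, h]
  simp
  field_simp
  norm_num

lemma dHSIC_eq_sum_tupleWeight {d n : ℕ} {𝒳 : Fin d → Type*} (k : ∀ j, 𝒳 j → 𝒳 j → ℝ)
    (hsymm : ∀ j x y, k j x y = k j y x) (x : Fin n → ∀ j, 𝒳 j) :
    dHSIC k x = ∑ a, tupleWeight d n (-1) a *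
      ∑ b, tupleWeight d n (-1) b * tensorKernel k x a b := by
  have hdiag : ∑ i : Fin n × Fin n, ∏ j, k j (x i.1 j) (x i.2 j) =
      ∑ i : Fin n, ∑ i' : Fin n, tensorKernel k x (fun _ => i) (fun _ => i') :=
    Fintype.sum_prod_type _
  have hfull : ∑ i : Fin (2*d) → Fin n, ∏ j : Fin d,
      k j (x (i ⟨2*j.val, by have := j.isLt; omega⟩) j)
          (x (i ⟨2*j.val+1, by have := j.isLt; omega⟩) j) =
      ∑ a : Fin d → Fin n, ∑ b : Fin d → Fin n, tensorKernel k x a b := by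
    rw [← Equiv.sum_comp (interleaveEquiv d (Fin n)), Fintype.sum_prod_type]
    simp only [interleaveEquiv_even, interleaveEquiv_odd, tensorKernel]
  have hcross : ∑ i : Fin (d+1) → Fin n, ∏ j : Fin d, k j (x (i 0) j) (x (i j.succ) j) =
      ∑ i : Fin n, ∑ b : Fin d → Fin n, tensorKernel k x (fun _ => i) b := by
    rw [← Equiv.sum_comp (Fin.consEquiv fun _ => Fin n), Fintype.sum_prod_type]
    simp [tensorKernel]
  have hcross' : ∑ a : Fin d → Fin n, ∑ i : Fin n, tensorKernel k x a (fun _ => i) =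
      ∑ i : Fin n, ∑ b : Fin d → Fin n, tensorKernel k x (fun _ => i) b := by
    rw [Finset.sum_comm]
    refine Finset.sum_congr rfl fun i _ => Finset.sum_congr rfl fun b _ => ?_
    exact Finset.prod_congr rfl fun j _ => hsymm j _ _
  unfold dHSIC
  rw [hdiag, hfull, hcross]
  simp only [sum_tupleWeight_mul, Finset.sum_add_distrib, ← Finset.mul_sum]
  rw [hcross']
  ring

lemma IsPSDKernel.exists_gram_factor {α : Type*} {k : α → α → ℝ} (hk : IsPSDKernel k) {n : ℕ}
    (x : Fin n → α) : ∃ B : Matrix (Fin n) (Fin n) ℝ,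
      ∀ i i', k (x i) (x i') = ∑ l, B l i * B l i' := by
  have hM : (Matrix.of fun i i' => k (x i) (x i')).PosSemidef := by
    refine .of_dotProduct_mulVec_nonneg (Matrix.IsHermitian.ext fun i i' => hk.1 _ _) fun c => ?_
    refine (hk.2 n x c).trans_eq ?_
    simp only [dotProduct, Matrix.mulVec, Finset.mul_sum]
    exact Finset.sum_congr rfl fun i _ => Finset.sum_congr rfl fun i' _ => by simp; ring
  open scoped MatrixOrder in
  obtain ⟨B, hB⟩ := CStarAlgebra.nonneg_iff_eq_star_mul_self.mp hM.nonneg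
  refine ⟨B, fun i i' => ?_⟩
  have := congrFun (congrFun hB i) i'
  simpa [Matrix.mul_apply] using this

lemma sum_sum_tensorKernel_nonneg {d n : ℕ} {𝒳 : Fin d → Type*} {k : ∀ j, 𝒳 j → 𝒳 j → ℝ}
    (hpsd : ∀ j, IsPSDKernel (k j)) (x : Fin n → ∀ j, 𝒳 j) (c : (Fin d → Fin n) → ℝ) :
    0 ≤ ∑ a, c a * ∑ b, c b * tensorKernel k x a b := by
  choose B hB using fun j => (hpsd j).exists_gram_factor (fun i => x i j)
  have hK : ∀ a b, tensorKernel k x a b =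
      ∑ l : Fin d → Fin n, (∏ j, B j (l j) (a j)) * ∏ j, B j (l j) (b j) := fun a b => by
    simp only [tensorKernel, hB, Finset.prod_univ_sum, Fintype.piFinset_univ,
      Finset.prod_mul_distrib]
  have hsq : ∑ a, c a * ∑ b, c b * tensorKernel k x a b =
      ∑ l : Fin d → Fin n, (∑ a, c a * ∏ j, B j (l j) (a j)) ^ 2 := by
    simp_rw [hK, sq, Finset.sum_mul_sum, Finset.mul_sum]
    conv_rhs => rw [Finset.sum_comm]
    refine Finset.sum_congr rfl fun a _ => ?_
    rw [Finset.sum_comm]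
    exact Finset.sum_congr rfl fun l _ => Finset.sum_congr rfl fun b _ => by ring
  rw [hsq]
  exact Finset.sum_nonneg fun l _ => sq_nonneg _

lemma dHSIC_nonneg {d n : ℕ} {𝒳 : Fin d → Type*} {k : ∀ j, 𝒳 j → 𝒳 j → ℝ}
    (hpsd : ∀ j, IsPSDKernel (k j)) (x : Fin n → ∀ j, 𝒳 j) : 0 ≤ dHSIC k x := by
  rw [dHSIC_eq_sum_tupleWeight k fun j => (hpsd j).1]
  exact sum_sum_tensorKernel_nonneg hpsd x _

lemma mul_le_sum_of_le_kthLargest {ι : Type*} [Fintype ι] {f : ι → ℝ} (hf : ∀ i, 0 ≤ f i)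
    {a : ℕ} {ε : ℝ} (h : ε ≤ kthLargest f a) (ha : a ≤ Fintype.card ι) :
    a * ε ≤ ∑ i, f i := by
  set l := (Finset.univ.val.map f).sort (· ≤ ·) with hl
  have hlen : l.length = Fintype.card ι := by simp [hl]
  have hsum : ∑ i, f i = l.sum := by
    rw [← Multiset.sum_coe, hl, Multiset.sort_eq]; rfl
  have hnonneg : ∀ y ∈ l, 0 ≤ y := by
    intro y hy
    rw [hl, Multiset.mem_sort, Multiset.mem_map] at hy
    obtain ⟨i, -, rfl⟩ := hy
    exact hf i
  have hsorted : l.Pairwise (· ≤ ·) := Multiset.pairwise_sort _ _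
  have hge : ∀ y ∈ l.drop (Fintype.card ι - a), ε ≤ y := by
    intro y hy
    obtain ⟨m, hm, rfl⟩ := List.mem_iff_getElem.mp hy
    rw [List.length_drop] at hm
    rw [List.getElem_drop]
    have hlt : Fintype.card ι - a < l.length := by omega
    have h' : ε ≤ l[Fintype.card ι - a] := by
      have : kthLargest f a = l[Fintype.card ι - a] := by
        unfold kthLargest
        rw [← hl, List.getD_eq_getElem _ _ hlt]
      exact this ▸ h
    exact h'.trans (hsorted.rel_get_of_le (a := ⟨_, hlt⟩) (b := ⟨_, by omega⟩) (by simp))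
  have hdrop := List.card_nsmul_le_sum _ ε hge
  rw [List.length_drop, hlen, Nat.sub_sub_self ha, nsmul_eq_mul] at hdrop
  have htake : 0 ≤ (l.take (Fintype.card ι - a)).sum :=
    List.sum_nonneg fun y hy => hnonneg y (List.mem_of_mem_take hy)
  rw [hsum, ← List.sum_take_add_sum_drop l (Fintype.card ι - a)]
  linarith

/-- The permutation that a permutation vector applies to the `j`-th coordinate. -/
def permAt {d n : ℕ} (ψ : Fin (d-1) → Equiv.Perm (Fin n)) (j : Fin d) : Equiv.Perm (Fin n) :=
  if h : j.val = 0 then 1 else ψ ⟨j.val - 1, by omega⟩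

lemma tensorKernel_permAct {d n : ℕ} {𝒳 : Fin d → Type*} (k : ∀ j, 𝒳 j → 𝒳 j → ℝ)
    (ψ : Fin (d-1) → Equiv.Perm (Fin n)) (D : Fin n → ∀ j, 𝒳 j) (a b : Fin d → Fin n) :
    tensorKernel k (permAct ψ D) a b =
      tensorKernel k D (fun j => permAt ψ j (a j)) (fun j => permAt ψ j (b j)) := by
  have h : ∀ i j, permAct ψ D i j = D (permAt ψ j i) j := fun i j => by
    unfold permAct permAt
    split_ifs <;> rfl
  simp only [tensorKernel, h]

lemma sum_permAt_eq_of_ne_zero {d n : ℕ} {j j' : Fin d} (hjj' : j ≠ j') (hj : j.val ≠ 0)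
    (u v : Fin n) :
    (n : ℝ) * ∑ ψ : Fin (d-1) → Equiv.Perm (Fin n),
      (if permAt ψ j u = permAt ψ j' v then (1 : ℝ) else 0) =
      Fintype.card (Fin (d-1) → Equiv.Perm (Fin n)) := by
  have : NeZero n := ⟨fun h => by subst h; exact u.elim0⟩
  let m : Fin (d-1) := ⟨j.val - 1, by omega⟩
  have hpj : ∀ (t : Fin n) (ψ : Fin (d-1) → Equiv.Perm (Fin n)),
      permAt (Pi.mulSingle m (Equiv.addLeft t) * ψ) j u = t + permAt ψ j u := fun t ψ => by
    simp [permAt, hj, m]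
  have hpj' : ∀ (t : Fin n) (ψ : Fin (d-1) → Equiv.Perm (Fin n)),
      permAt (Pi.mulSingle m (Equiv.addLeft t) * ψ) j' v = permAt ψ j' v := fun t ψ => by
    by_cases h0 : j'.val = 0
    · simp [permAt, h0]
    · have hne : (⟨j'.val - 1, by omega⟩ : Fin (d-1)) ≠ m := fun h => by
        have := congrArg Fin.val h
        simp only [m] at this
        exact hjj' (Fin.ext (by omega))
      simp [permAt, h0, Pi.mulSingle_eq_of_ne hne]
  have hshift : ∀ t : Fin n, ∑ ψ : Fin (d-1) → Equiv.Perm (Fin n),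
      (if permAt ψ j u = permAt ψ j' v then (1 : ℝ) else 0) =
      ∑ ψ : Fin (d-1) → Equiv.Perm (Fin n),
        (if t + permAt ψ j u = permAt ψ j' v then (1 : ℝ) else 0) := fun t => by
    rw [← Equiv.sum_comp (Equiv.mulLeft (Pi.mulSingle m (Equiv.addLeft t)))]
    simp only [Equiv.coe_mulLeft, hpj, hpj']
  calc (n : ℝ) * ∑ ψ : Fin (d-1) → Equiv.Perm (Fin n),
        (if permAt ψ j u = permAt ψ j' v then (1 : ℝ) else 0)
      = ∑ t : Fin n, ∑ ψ : Fin (d-1) → Equiv.Perm (Fin n),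
          (if t + permAt ψ j u = permAt ψ j' v then (1 : ℝ) else 0) := by simp [← hshift]
    _ = Fintype.card (Fin (d-1) → Equiv.Perm (Fin n)) := by
        rw [Finset.sum_comm]
        simp [← eq_sub_iff_add_eq]

lemma sum_permAt_eq {d n : ℕ} {j j' : Fin d} (hjj' : j ≠ j') (u v : Fin n) :
    ∑ ψ : Fin (d-1) → Equiv.Perm (Fin n),
      (if permAt ψ j u = permAt ψ j' v then (1 : ℝ) else 0) =
      Fintype.card (Fin (d-1) → Equiv.Perm (Fin n)) / n := by
  have hn : (n : ℝ) ≠ 0 := by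
    have : n ≠ 0 := fun h => by subst h; exact u.elim0
    exact_mod_cast this
  rw [eq_div_iff hn, mul_comm]
  by_cases hj : j.val = 0
  · have hj' : j'.val ≠ 0 := fun h => hjj' (Fin.ext (by omega))
    simp only [← sum_permAt_eq_of_ne_zero hjj'.symm hj' v u, eq_comm]
  · exact sum_permAt_eq_of_ne_zero hjj' hj u v

/-- The number of coincidences among the coordinates of two index tuples after permutation. -/
noncomputable def collisionCount {d n : ℕ} (ψ : Fin (d-1) → Equiv.Perm (Fin n))
    (a b : Fin d → Fin n) : ℝ :=
  ∑ j, (if b j = a j then 1 else 0) + ∑ j : Fin d, ∑ j' : Fin d, if j = j' then 0 else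
    ((if permAt ψ j (a j) = permAt ψ j' (a j') then 1 else 0) +
      (if permAt ψ j (a j) = permAt ψ j' (b j') then 1 else 0) +
      (if permAt ψ j (b j) = permAt ψ j' (b j') then 1 else 0))

lemma collisionCount_nonneg {d n : ℕ} (ψ : Fin (d-1) → Equiv.Perm (Fin n))
    (a b : Fin d → Fin n) : 0 ≤ collisionCount ψ a b := by
  unfold collisionCount
  refine add_nonneg (Finset.sum_nonneg fun j _ => ?_)
    (Finset.sum_nonneg fun j _ => Finset.sum_nonneg fun j' _ => ?_) <;>
  · split_ifs <;> norm_num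

lemma one_le_collisionCount {d n : ℕ} {ψ : Fin (d-1) → Equiv.Perm (Fin n)}
    {a b : Fin d → Fin n}
    (h : ¬ Function.Injective (interleaveEquiv d (Fin n)
      (fun j => permAt ψ j (a j), fun j => permAt ψ j (b j)))) :
    1 ≤ collisionCount ψ a b := by
  have hfst : 0 ≤ ∑ j, (if b j = a j then (1 : ℝ) else 0) :=
    Finset.sum_nonneg fun j _ => by split_ifs <;> norm_num
  have hterm : ∀ j j' : Fin d, (0 : ℝ) ≤ if j = j' then 0 else
      ((if permAt ψ j (a j) = permAt ψ j' (a j') then 1 else 0) +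
        (if permAt ψ j (a j) = permAt ψ j' (b j') then 1 else 0) +
        (if permAt ψ j (b j) = permAt ψ j' (b j') then 1 else 0)) := fun j j' => by
    split_ifs <;> norm_num
  have hsnd := Finset.sum_nonneg fun j (_ : j ∈ Finset.univ) =>
    Finset.sum_nonneg fun j' (_ : j' ∈ Finset.univ) => hterm j j'
  have hdiag : ∀ j, b j = a j → 1 ≤ collisionCount ψ a b := fun j hj => by
    have := Finset.single_le_sum (f := fun j => if b j = a j then (1 : ℝ) else 0)
      (fun j _ => by split_ifs <;> norm_num) (Finset.mem_univ j)
    simp only [hj, if_true] at this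
    unfold collisionCount
    linarith
  have hoff : ∀ j j' : Fin d, j ≠ j' → (permAt ψ j (a j) = permAt ψ j' (a j') ∨
      permAt ψ j (a j) = permAt ψ j' (b j') ∨ permAt ψ j (b j) = permAt ψ j' (b j')) →
      1 ≤ collisionCount ψ a b := fun j j' hne hcoll => by
    have h1 := Finset.single_le_sum (fun j (_ : j ∈ Finset.univ) =>
      Finset.sum_nonneg fun j' (_ : j' ∈ Finset.univ) => hterm j j') (Finset.mem_univ j)
    have h2 := Finset.single_le_sum (fun j' (_ : j' ∈ Finset.univ) => hterm j j')
      (Finset.mem_univ j')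
    have h3 : (1 : ℝ) ≤ if j = j' then 0 else
      ((if permAt ψ j (a j) = permAt ψ j' (a j') then 1 else 0) +
        (if permAt ψ j (a j) = permAt ψ j' (b j') then 1 else 0) +
        (if permAt ψ j (b j) = permAt ψ j' (b j') then 1 else 0)) := by
      rw [if_neg hne]
      split_ifs <;> first | (exfalso; tauto) | norm_num
    unfold collisionCount
    linarith
  rw [Function.Injective] at h
  push Not at h
  obtain ⟨m, m', heq, hne⟩ := h
  have hval : m.val ≠ m'.val := fun h => hne (Fin.ext h)
  simp only [interleaveEquiv, Equiv.coe_fn_mk] at heq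
  by_cases hq : m.val / 2 = m'.val / 2
  · have hq' : (⟨m'.val / 2, by omega⟩ : Fin d) = ⟨m.val / 2, by omega⟩ := Fin.ext hq.symm
    refine hdiag ⟨m.val / 2, by omega⟩ ?_
    rw [hq'] at heq
    split_ifs at heq with h1 h2 h2
    · omega
    · exact ((permAt ψ _).injective heq).symm
    · exact (permAt ψ _).injective heq
    · omega
  · have hq' : (⟨m.val / 2, by omega⟩ : Fin d) ≠ ⟨m'.val / 2, by omega⟩ :=
      fun h => hq (congrArg Fin.val h)
    split_ifs at heq
    · exact hoff _ _ hq' (Or.inl heq)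
    · exact hoff _ _ hq' (Or.inr (Or.inl heq))
    · exact hoff _ _ hq'.symm (Or.inr (Or.inl heq.symm))
    · exact hoff _ _ hq' (Or.inr (Or.inr heq))

lemma sum_collisionCount_le {d n : ℕ} (a b : Fin d → Fin n) :
    ∑ ψ : Fin (d-1) → Equiv.Perm (Fin n), collisionCount ψ a b ≤
      Fintype.card (Fin (d-1) → Equiv.Perm (Fin n)) *
        (∑ j, (if b j = a j then 1 else 0) + 3 * (d : ℝ) ^ 2 / n) := by
  set N : ℝ := (Fintype.card (Fin (d-1) → Equiv.Perm (Fin n)) : ℝ)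
  have hoff : ∀ j j' : Fin d, (∑ ψ : Fin (d-1) → Equiv.Perm (Fin n), if j = j' then (0 : ℝ) else
      ((if permAt ψ j (a j) = permAt ψ j' (a j') then 1 else 0) +
        (if permAt ψ j (a j) = permAt ψ j' (b j') then 1 else 0) +
        (if permAt ψ j (b j) = permAt ψ j' (b j') then 1 else 0))) ≤ 3 * (N / n) := by
    intro j j'
    by_cases h : j = j'
    · simp only [h, if_true, Finset.sum_const_zero]
      positivity
    · simp only [h, if_false, Finset.sum_add_distrib, sum_permAt_eq h]
      linarith
  unfold collisionCount
  rw [Finset.sum_add_distrib, Finset.sum_const, Finset.card_univ, nsmul_eq_mul, mul_add,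
    Finset.sum_comm]
  gcongr
  calc _ ≤ ∑ j : Fin d, ∑ j' : Fin d, 3 * (N / n) := by
        refine Finset.sum_le_sum fun j _ => ?_
        rw [Finset.sum_comm]
        exact Finset.sum_le_sum fun j' _ => hoff j j'
    _ = N * (3 * (d : ℝ) ^ 2 / n) := by
        simp only [Finset.sum_const, Finset.card_univ, Fintype.card_fin, nsmul_eq_mul]
        ring

lemma sum_tupleWeight_mul_collision {d n : ℕ} (hn : n ≠ 0) :
    ∑ a, tupleWeight d n 1 a * ∑ b, tupleWeight d n 1 b *
        (∑ j, (if b j = a j then 1 else 0) + 3 * (d : ℝ) ^ 2 / n) =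
      (4 * d + 12 * d ^ 2) / n := by
  have hinner : ∀ a : Fin d → Fin n, ∑ b, tupleWeight d n 1 b *
      (∑ j, (if b j = a j then 1 else 0) + 3 * (d : ℝ) ^ 2 / n) =
      d * (2 / n) + 2 * (3 * (d : ℝ) ^ 2 / n) := fun a => by
    simp only [mul_add, Finset.sum_add_distrib, Finset.mul_sum]
    rw [Finset.sum_comm]
    simp only [sum_tupleWeight_one_coord_eq, ← Finset.sum_mul, sum_tupleWeight hn]
    norm_num
  simp only [hinner, ← Finset.sum_mul, sum_tupleWeight hn]
  ring

lemma measurePreserving_comp_injective {ι κ Ω : Type*} [Fintype ι] [Fintype κ]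
    [MeasurableSpace Ω] (μ : Measure Ω) [IsProbabilityMeasure μ] {e : ι → κ}
    (he : Function.Injective e) :
    MeasurePreserving (fun D : κ → Ω => fun i => D (e i))
      (Measure.pi fun _ => μ) (Measure.pi fun _ => μ) := by
  refine ⟨measurable_pi_lambda _ fun i => measurable_pi_apply _, ?_⟩
  have hind : iIndepFun (fun (i : κ) (D : κ → Ω) => D i) (Measure.pi fun _ : κ => μ) :=
    iIndepFun_pi (X := fun _ => id) fun _ => aemeasurable_id
  have h := (hind.precomp he).map_fun_eq_pi_map fun i => (measurable_pi_apply _).aemeasurable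
  refine h.trans ?_
  congr 1
  ext1 i
  exact (measurePreserving_eval (fun _ : κ => μ) (e i)).map_eq

lemma exists_injective_factor {m n : ℕ} (hmn : m ≤ n) (s : Fin m → Fin n) :
    ∃ (e : Fin m → Fin n) (τ : Fin m → Fin m), Function.Injective e ∧ ∀ i, s i = e (τ i) := by
  obtain ⟨T, hT, -, hcard⟩ := Finset.exists_subsuperset_card_eq
    (Finset.subset_univ (Finset.univ.image s))
    (Finset.card_image_le.trans (by simp) : (Finset.univ.image s).card ≤ m) (by simpa using hmn)
  have hmem : ∀ i, s i ∈ T := fun i => hT (Finset.mem_image_of_mem s (Finset.mem_univ i))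
  let φ := T.equivFinOfCardEq hcard
  exact ⟨fun i => φ.symm i, fun i => φ ⟨s i, hmem i⟩,
    Subtype.val_injective.comp φ.symm.injective, fun i => by simp⟩

lemma measurable_tensorKernel {ι : Type*} {d : ℕ} {𝒳 : Fin d → Type*}
    [∀ j, MeasurableSpace (𝒳 j)] {k : ∀ j, 𝒳 j → 𝒳 j → ℝ}
    (hk : ∀ j, Measurable (fun p : 𝒳 j × 𝒳 j => k j p.1 p.2)) (a b : Fin d → ι) :
    Measurable fun D : ι → ∀ j, 𝒳 j => tensorKernel k D a b := by
  refine Finset.measurable_prod _ fun j _ => ?_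
  exact (hk j).comp (((measurable_pi_apply j).comp (measurable_pi_apply (a j))).prodMk
    ((measurable_pi_apply j).comp (measurable_pi_apply (b j))))

/-- Under `Assumption1`, every product of kernel values at sample points is integrable, with a
uniform bound on the expectations and a common expectation for distinct indices. -/
lemma exists_bound_integral_tensorKernel {d : ℕ} {𝒳 : Fin d → Type*}
    [∀ j, MeasurableSpace (𝒳 j)] {k : ∀ j, 𝒳 j → 𝒳 j → ℝ}
    (hk : ∀ j, Measurable (fun p : 𝒳 j × 𝒳 j => k j p.1 p.2))
    (μ : Measure (∀ j, 𝒳 j)) [IsProbabilityMeasure μ] (hA1 : Assumption1 k μ) :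
    ∃ C θ : ℝ, 0 ≤ C ∧ |θ| ≤ C ∧ ∀ n, 2 * d ≤ n → ∀ a b : Fin d → Fin n,
      Integrable (fun D => tensorKernel k D a b) (Measure.pi fun _ : Fin n => μ) ∧
      |∫ D, tensorKernel k D a b ∂(Measure.pi fun _ : Fin n => μ)| ≤ C ∧
      (Function.Injective (interleaveEquiv d (Fin n) (a, b)) →
        ∫ D, tensorKernel k D a b ∂(Measure.pi fun _ : Fin n => μ) = θ) := by
  obtain ⟨C, hC⟩ := hA1
  let ν : Measure (Fin (2 * d) → ∀ j, 𝒳 j) := Measure.pi fun _ => μ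
  have hbase : ∀ a b : Fin d → Fin (2 * d), Integrable (fun D => tensorKernel k D a b) ν ∧
      |∫ D, tensorKernel k D a b ∂ν| ≤ max C 0 := by
    intro a b
    have hlint : ∫⁻ D, ENNReal.ofReal |tensorKernel k D a b| ∂ν ≤ ENNReal.ofReal C := by
      have := hC (interleaveEquiv d _ (a, b))
      simp only [interleaveEquiv_even, interleaveEquiv_odd, Measure.restrict_univ] at this
      exact this
    have hmeas := measurable_tensorKernel hk a b
    refine ⟨⟨hmeas.aestronglyMeasurable, ?_⟩, ?_⟩
    · rw [hasFiniteIntegral_iff_norm]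
      exact hlint.trans_lt ENNReal.ofReal_lt_top
    · refine abs_integral_le_integral_abs.trans ?_
      rw [integral_eq_lintegral_of_nonneg_ae (ae_of_all _ fun _ => abs_nonneg _)
        hmeas.abs.aestronglyMeasurable]
      refine (ENNReal.toReal_mono ENNReal.ofReal_ne_top hlint).trans ?_
      rw [ENNReal.toReal_ofReal']
  let p := (interleaveEquiv d (Fin (2 * d))).symm id
  refine ⟨max C 0, ∫ D, tensorKernel k D p.1 p.2 ∂ν, le_max_right _ _, (hbase _ _).2,
    fun n hn a b => ?_⟩
  have htransfer : ∀ (e : Fin (2 * d) → Fin n) (τ : Fin (2 * d) → Fin (2 * d)),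
      Function.Injective e → (∀ i, interleaveEquiv d (Fin n) (a, b) i = e (τ i)) →
      Integrable (fun D => tensorKernel k D a b) (Measure.pi fun _ : Fin n => μ) ∧
      ∫ D, tensorKernel k D a b ∂(Measure.pi fun _ : Fin n => μ) =
        ∫ D, tensorKernel k D ((interleaveEquiv d _).symm τ).1
          ((interleaveEquiv d _).symm τ).2 ∂ν := by
    intro e τ he hτ
    have hmp := measurePreserving_comp_injective μ he
    have ha : ∀ j, a j = e (((interleaveEquiv d _).symm τ).1 j) := fun j => by
      rw [← interleaveEquiv_even a b j (by omega), hτ]; rfl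
    have hb : ∀ j, b j = e (((interleaveEquiv d _).symm τ).2 j) := fun j => by
      rw [← interleaveEquiv_odd a b j (by omega), hτ]; rfl
    have hfun : (fun D : Fin n → ∀ j, 𝒳 j => tensorKernel k D a b) =
        fun D => tensorKernel k (fun i => D (e i)) ((interleaveEquiv d _).symm τ).1
          ((interleaveEquiv d _).symm τ).2 := by
      ext D
      simp only [tensorKernel, ha, hb]
    rw [hfun]
    refine ⟨hmp.integrable_comp_of_integrable (hbase _ _).1, ?_⟩
    rw [show ν = _ from hmp.map_eq.symm, integral_map hmp.measurable.aemeasurable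
      (measurable_tensorKernel hk _ _).aestronglyMeasurable]
  obtain ⟨e, τ, he, hτ⟩ := exists_injective_factor hn (interleaveEquiv d (Fin n) (a, b))
  obtain ⟨hint, heq⟩ := htransfer e τ he hτ
  exact ⟨hint, heq ▸ (hbase _ _).2, fun hinj => (htransfer _ id hinj fun _ => rfl).2⟩

lemma integrable_dHSIC_permAct {d n : ℕ} {𝒳 : Fin d → Type*}
    [∀ j, MeasurableSpace (𝒳 j)] {k : ∀ j, 𝒳 j → 𝒳 j → ℝ}
    (hsymm : ∀ j x y, k j x y = k j y x) {ν : Measure (Fin n → ∀ j, 𝒳 j)}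
    (hint : ∀ a b, Integrable (fun D => tensorKernel k D a b) ν)
    (ψ : Fin (d-1) → Equiv.Perm (Fin n)) :
    Integrable (fun D => dHSIC k (permAct ψ D)) ν := by
  simp only [dHSIC_eq_sum_tupleWeight k hsymm, tensorKernel_permAct]
  exact integrable_finsetSum _ fun a _ => (integrable_finsetSum _ fun b _ =>
    (hint _ _).const_mul _).const_mul _

lemma integral_dHSIC_permAct {d n : ℕ} {𝒳 : Fin d → Type*}
    [∀ j, MeasurableSpace (𝒳 j)] {k : ∀ j, 𝒳 j → 𝒳 j → ℝ}
    (hsymm : ∀ j x y, k j x y = k j y x) {ν : Measure (Fin n → ∀ j, 𝒳 j)}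
    (hint : ∀ a b, Integrable (fun D => tensorKernel k D a b) ν)
    (ψ : Fin (d-1) → Equiv.Perm (Fin n)) :
    ∫ D, dHSIC k (permAct ψ D) ∂ν = ∑ a, tupleWeight d n (-1) a * ∑ b, tupleWeight d n (-1) b *
      ∫ D, tensorKernel k D (fun j => permAt ψ j (a j)) (fun j => permAt ψ j (b j)) ∂ν := by
  simp only [dHSIC_eq_sum_tupleWeight k hsymm, tensorKernel_permAct]
  rw [integral_finsetSum _ fun a _ => (integrable_finsetSum _ fun b _ =>
    (hint _ _).const_mul _).const_mul _]
  refine Finset.sum_congr rfl fun a _ => ?_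
  rw [integral_const_mul, integral_finsetSum _ fun b _ => (hint _ _).const_mul _]
  simp only [integral_const_mul]

lemma integral_dHSIC_permAct_le {d n : ℕ} (hn : n ≠ 0) {𝒳 : Fin d → Type*}
    [∀ j, MeasurableSpace (𝒳 j)] {k : ∀ j, 𝒳 j → 𝒳 j → ℝ}
    (hsymm : ∀ j x y, k j x y = k j y x) {ν : Measure (Fin n → ∀ j, 𝒳 j)}
    (hint : ∀ a b, Integrable (fun D => tensorKernel k D a b) ν) {C θ : ℝ} (hC : 0 ≤ C)
    (hθ : |θ| ≤ C) (hbound : ∀ a b, |∫ D, tensorKernel k D a b ∂ν| ≤ C)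
    (hdistinct : ∀ a b, Function.Injective (interleaveEquiv d (Fin n) (a, b)) →
      ∫ D, tensorKernel k D a b ∂ν = θ)
    (ψ : Fin (d-1) → Equiv.Perm (Fin n)) :
    ∫ D, dHSIC k (permAct ψ D) ∂ν ≤ 2 * C * ∑ a, tupleWeight d n 1 a *
      ∑ b, tupleWeight d n 1 b * collisionCount ψ a b := by
  set g : (Fin d → Fin n) → (Fin d → Fin n) → ℝ := fun a b =>
    ∫ D, tensorKernel k D (fun j => permAt ψ j (a j)) (fun j => permAt ψ j (b j)) ∂ν
  have hdev : ∀ a b, |g a b - θ| ≤ 2 * C * collisionCount ψ a b := fun a b => by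
    by_cases hinj : Function.Injective (interleaveEquiv d (Fin n)
      (fun j => permAt ψ j (a j), fun j => permAt ψ j (b j)))
    · rw [show g a b = θ from hdistinct _ _ hinj, sub_self, abs_zero]
      exact mul_nonneg (by positivity) (collisionCount_nonneg ψ a b)
    · have hgC : |g a b| ≤ C := hbound _ _
      calc |g a b - θ| ≤ |g a b| + |θ| := abs_sub _ _
        _ ≤ 2 * C * 1 := by linarith
        _ ≤ _ := by gcongr; exact one_le_collisionCount hinj
  have hzero : ∑ b, tupleWeight d n (-1) b * θ = 0 := by
    rw [← Finset.sum_mul, sum_tupleWeight hn]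
    ring
  rw [integral_dHSIC_permAct hsymm hint]
  calc ∑ a, tupleWeight d n (-1) a * ∑ b, tupleWeight d n (-1) b * g a b
      = ∑ a, tupleWeight d n (-1) a * ∑ b, tupleWeight d n (-1) b * (g a b - θ) := by
        simp only [mul_sub, Finset.sum_sub_distrib, hzero, sub_zero]
    _ ≤ ∑ a, tupleWeight d n 1 a *
          ∑ b, tupleWeight d n 1 b * (2 * C * collisionCount ψ a b) := by
        refine Finset.sum_le_sum fun a _ => (le_abs_self _).trans ?_
        rw [abs_mul]
        refine mul_le_mul (abs_tupleWeight_le a) ?_ (abs_nonneg _)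
          (tupleWeight_nonneg zero_le_one a)
        refine (Finset.abs_sum_le_sum_abs _ _).trans (Finset.sum_le_sum fun b _ => ?_)
        rw [abs_mul]
        exact mul_le_mul (abs_tupleWeight_le b) (hdev a b) (abs_nonneg _)
          (tupleWeight_nonneg zero_le_one b)
    _ = _ := by
        simp only [Finset.mul_sum]
        exact Finset.sum_congr rfl fun a _ => Finset.sum_congr rfl fun b _ => by ring

/-- The mean of the permuted dHSIC statistics over sample and permutations is `O(1/n)`. -/
lemma exists_integral_sum_dHSIC_permAct_le {d : ℕ} (hd : d ≠ 0) {𝒳 : Fin d → Type*}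
    [∀ j, MeasurableSpace (𝒳 j)] {k : ∀ j, 𝒳 j → 𝒳 j → ℝ}
    (hk : ∀ j, Measurable (fun p : 𝒳 j × 𝒳 j => k j p.1 p.2))
    (hsymm : ∀ j x y, k j x y = k j y x)
    (μ : Measure (∀ j, 𝒳 j)) [IsProbabilityMeasure μ] (hA1 : Assumption1 k μ) :
    ∃ K : ℝ, 0 ≤ K ∧ ∀ n, 2 * d ≤ n →
      Integrable (fun D => ∑ ψ : Fin (d-1) → Equiv.Perm (Fin n), dHSIC k (permAct ψ D))
        (Measure.pi fun _ : Fin n => μ) ∧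
      ∫ D, ∑ ψ : Fin (d-1) → Equiv.Perm (Fin n), dHSIC k (permAct ψ D)
          ∂(Measure.pi fun _ : Fin n => μ) ≤
        Fintype.card (Fin (d-1) → Equiv.Perm (Fin n)) * (K / n) := by
  obtain ⟨C, θ, hC, hθ, h⟩ := exists_bound_integral_tensorKernel hk μ hA1
  refine ⟨2 * C * (4 * d + 12 * d ^ 2), by positivity, fun n hn => ?_⟩
  have hn0 : n ≠ 0 := by omega
  have hint := fun a b => (h n hn a b).1
  have hintψ := integrable_dHSIC_permAct hsymm hint
  refine ⟨integrable_finsetSum _ fun ψ _ => hintψ ψ, ?_⟩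
  rw [integral_finsetSum _ fun ψ _ => hintψ ψ]
  set N : ℝ := (Fintype.card (Fin (d-1) → Equiv.Perm (Fin n)) : ℝ)
  calc _ ≤ ∑ ψ : Fin (d-1) → Equiv.Perm (Fin n), 2 * C * ∑ a, tupleWeight d n 1 a *
          ∑ b, tupleWeight d n 1 b * collisionCount ψ a b :=
        Finset.sum_le_sum fun ψ _ => integral_dHSIC_permAct_le hn0 hsymm hint hC hθ
          (fun a b => (h n hn a b).2.1) (fun a b => (h n hn a b).2.2) ψ
    _ = 2 * C * ∑ a, tupleWeight d n 1 a * ∑ b, tupleWeight d n 1 b *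
          ∑ ψ : Fin (d-1) → Equiv.Perm (Fin n), collisionCount ψ a b := by
        rw [← Finset.mul_sum, Finset.sum_comm]
        congr 1
        refine Finset.sum_congr rfl fun a _ => ?_
        rw [← Finset.mul_sum, Finset.sum_comm]
        simp only [Finset.mul_sum]
    _ ≤ 2 * C * ∑ a, tupleWeight d n 1 a * ∑ b, tupleWeight d n 1 b *
          (N * (∑ j, (if b j = a j then 1 else 0) + 3 * (d : ℝ) ^ 2 / n)) := by
        gcongr with a _ b _
        · exact tupleWeight_nonneg zero_le_one a
        · exact tupleWeight_nonneg zero_le_one b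
        · exact sum_collisionCount_le a b
    _ = 2 * C * N * ∑ a, tupleWeight d n 1 a * ∑ b, tupleWeight d n 1 b *
          (∑ j, (if b j = a j then 1 else 0) + 3 * (d : ℝ) ^ 2 / n) := by
        simp only [mul_left_comm _ N, ← Finset.mul_sum]
        ring
    _ = _ := by
        rw [sum_tupleWeight_mul_collision hn0]
        ring

/-- **The `⌊α (n!)^{d-1}⌋`-th largest permuted dHSIC statistic converges to zero in
probability.**  Assume each kernel is positive semidefinite and Assumption 1 holds,
and let `μ` be a distribution that is not the product of its marginals.  Order the
values `dHSIĈ(ψ D)` over all `(n!)^{d-1}` permutation vectors decreasingly as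
`t_n^1(D) ≥ t_n^2(D) ≥ …`, and set `a = ⌊α (n!)^{d-1}⌋` for `α ∈ (0,1)`.
Then `t_n^a(D) → 0` in probability as `n → ∞`. -/
theorem quantile_permuted_dHSIC_tendsto_zero
    {d : ℕ} (hd : 2 ≤ d)
    (𝒳 : Fin d → Type*) [∀ j, MeasurableSpace (𝒳 j)]
    (k : ∀ j, 𝒳 j → 𝒳 j → ℝ)
    (hk : ∀ j, Measurable (fun p : 𝒳 j × 𝒳 j => k j p.1 p.2))
    (hpsd : ∀ j, IsPSDKernel (k j))
    (μ : Measure (∀ j, 𝒳 j)) [IsProbabilityMeasure μ]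
    (hA1 : Assumption1 k μ)
    (halt : μ ≠ Measure.pi (fun j => μ.map (fun x => x j)))
    (α : ℝ) (hα : α ∈ Set.Ioo (0:ℝ) 1)
    (ε : ℝ) (hε : 0 < ε) :
    Tendsto (fun n : ℕ =>
        (Measure.pi fun _ : Fin n => μ)
          {D | ε ≤ kthLargest
              (fun ψ : Fin (d-1) → Equiv.Perm (Fin n) => dHSIC k (permAct ψ D))
              (⌊α * ((n.factorial : ℝ)) ^ (d-1)⌋₊)})
      atTop (nhds 0) := by
  obtain ⟨K, hK, hbound⟩ := exists_integral_sum_dHSIC_permAct_le (by omega) hk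
    (fun j => (hpsd j).1) μ hA1
  have hlim : Tendsto (fun n : ℕ => ENNReal.ofReal (2 * K / (α * ε) / n)) atTop (nhds 0) := by
    simpa using ENNReal.tendsto_ofReal (tendsto_const_div_atTop_nhds_zero_nat (2 * K / (α * ε)))
  refine tendsto_of_tendsto_of_tendsto_of_le_of_le' tendsto_const_nhds hlim
    (Eventually.of_forall fun _ => zero_le) ?_
  filter_upwards [eventually_ge_atTop (2 * d), eventually_ge_atTop ⌈2 / α⌉₊] with n hn hnα
  obtain ⟨hint, hle⟩ := hbound n hn
  set ν : Measure (Fin n → ∀ j, 𝒳 j) := Measure.pi fun _ => μ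
  set F : (Fin n → ∀ j, 𝒳 j) → ℝ := fun D =>
    ∑ ψ : Fin (d-1) → Equiv.Perm (Fin n), dHSIC k (permAct ψ D)
  have hcard : (Fintype.card (Fin (d-1) → Equiv.Perm (Fin n)) : ℝ) =
      (n.factorial : ℝ) ^ (d-1) := by
    simp [Fintype.card_perm]
  rw [hcard] at hle
  set N : ℝ := (n.factorial : ℝ) ^ (d-1)
  set a : ℕ := ⌊α * N⌋₊
  have hα0 := hα.1
  have hn0 : (0 : ℝ) < n := by exact_mod_cast (by omega : 0 < n)
  have hnN : (n : ℝ) ≤ N := by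
    have h1 : n ≤ n.factorial ^ (d-1) :=
      n.self_le_factorial.trans (Nat.le_self_pow (by omega) _)
    calc (n : ℝ) ≤ ((n.factorial ^ (d-1) : ℕ) : ℝ) := Nat.cast_le.mpr h1
      _ = N := Nat.cast_pow _ _
  have hαN : 2 ≤ α * N := by
    have h1 : 2 / α ≤ N := (Nat.ceil_le.mp hnα).trans hnN
    rwa [div_le_iff₀ hα0, mul_comm] at h1
  have ha_ge : α * N / 2 ≤ a := by linarith [Nat.lt_floor_add_one (α * N)]
  have ha_le : a ≤ Fintype.card (Fin (d-1) → Equiv.Perm (Fin n)) := by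
    have h1 : (a : ℝ) ≤ α * N := Nat.floor_le (by linarith)
    have h2 : α * N ≤ N := mul_le_of_le_one_left (by linarith) hα.2.le
    exact_mod_cast (h1.trans h2).trans hcard.ge
  have hmarkov := mul_meas_ge_le_integral_of_nonneg (μ := ν) (f := F)
    (ae_of_all _ fun D => Finset.sum_nonneg fun ψ _ => dHSIC_nonneg hpsd _) hint (a * ε)
  have hN : 0 < N := hn0.trans_le hnN
  have hreal : ν.real {D | a * ε ≤ F D} ≤ 2 * K / (α * ε) / n := by
    have h1 : α * N / 2 * ε * ν.real {D | a * ε ≤ F D} ≤ N * (K / n) :=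
      (by gcongr : _ ≤ a * ε * ν.real {D | a * ε ≤ F D}).trans (hmarkov.trans hle)
    rw [← le_div_iff₀' (by positivity)] at h1
    refine h1.trans_eq ?_
    field_simp
  calc _ ≤ ν {D | a * ε ≤ F D} := measure_mono fun D hD =>
        mul_le_sum_of_le_kthLargest (fun ψ => dHSIC_nonneg hpsd _) hD ha_le
    _ = ENNReal.ofReal (ν.real {D | a * ε ≤ F D}) := (ofReal_measureReal).symm
    _ ≤ _ := ENNReal.ofReal_le_ofReal hreal
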